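/- arXiv:2212.07193 — 3 statements merged into one kernel-verified Lean document; each statement's English description precedes it below -/
import Mathlib

section
/- If G and H are connected graphs, then μt(G □ H) = 0 if and only if μt(G) = 0 or μt(H) = 0. -/
open SimpleGraph

/-- `X` is a total mutual-visibility set of `G`: every pair of vertices `x, y` admits a
shortest `x,y`-path whose vertices in `X` are among `{x, y}`. -/
def IsTotalMVSet {V : Type*} (G : SimpleGraph V) (X : Set V) : Prop :=
  ∀ x y : V, ∃ p : G.Walk x y, p.IsPath ∧ p.length = G.dist x y ∧
    ∀ z ∈ p.support, z ∈ X → z = x ∨ z = y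

/-- The total mutual-visibility number of `G`. -/
noncomputable def totalMVNum {V : Type*} (G : SimpleGraph V) : ℕ :=
  sSup {n : ℕ | ∃ X : Set V, IsTotalMVSet G X ∧ X.ncard = n}

/-- `S` is an independent set of `G`. -/
def IsIndepVSet {V : Type*} (G : SimpleGraph V) (S : Set V) : Prop :=
  ∀ x ∈ S, ∀ y ∈ S, ¬ G.Adj x y

/-- The independent total mutual-visibility number of `G`. -/
noncomputable def indepTotalMVNum {V : Type*} (G : SimpleGraph V) : ℕ :=
  sSup {n : ℕ | ∃ X : Set V, IsTotalMVSet G X ∧ IsIndepVSet G X ∧ X.ncard = n}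

/-- `u` is a bypass vertex of `G` if it is not the middle vertex of a convex path of
length 2, i.e. there are no vertices `x ≠ y` with `x, y` nonadjacent and `u` their unique
common neighbour. -/
def IsBypassVertex {V : Type*} (G : SimpleGraph V) (u : V) : Prop :=
  ¬ ∃ x y : V, x ≠ y ∧ ¬ G.Adj x y ∧ G.Adj x u ∧ G.Adj u y ∧
      ∀ w : V, G.Adj x w → G.Adj w y → w = u

/-- The number of bypass vertices of `G`. -/
noncomputable def bpNum {V : Type*} (G : SimpleGraph V) : ℕ :=
  {u : V | IsBypassVertex G u}.ncard

theorem IsTotalMVSet.subset {V : Type*} {G : SimpleGraph V} {X Y : Set V}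
    (hY : IsTotalMVSet G Y) (hXY : X ⊆ Y) : IsTotalMVSet G X := fun x y =>
  let ⟨p, hp, hl, hv⟩ := hY x y
  ⟨p, hp, hl, fun z hz hzX => hv z hz (hXY hzX)⟩

/-- A geodesic through a bypass vertex can be rerouted to avoid it in its interior. -/
theorem IsBypassVertex.exists_walk {V : Type*} {G : SimpleGraph V} {u : V}
    (hu : IsBypassVertex G u) {x y : V} (p : G.Walk x y) (hp : p.length = G.dist x y) :
    ∃ q : G.Walk x y, q.length = G.dist x y ∧ (u ∈ q.support → u = x ∨ u = y) := by
  induction p with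
  | nil => exact ⟨.nil, hp, fun h => .inl (by simpa using h)⟩
  | @cons x v y hxv p ih =>
    have hpv : p.length = G.dist v y := by
      refine le_antisymm ?_ (dist_le p)
      obtain ⟨r, hr⟩ := p.reachable.exists_walk_length_eq_dist
      have := dist_le (Walk.cons hxv r)
      simp only [Walk.length_cons] at this hp
      omega
    obtain ⟨q, hq, hqu⟩ := ih hpv
    have hlen : (Walk.cons hxv q).length = G.dist x y := by
      rw [← hp, Walk.length_cons, Walk.length_cons, hq, hpv]
    by_cases huv : u = v
    · subst huv
      cases q with
      | nil => exact ⟨.cons hxv .nil, hlen, fun _ => .inr rfl⟩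
      | @cons _ w _ huw r =>
        have hxw : x ≠ w := by
          rintro rfl
          have := dist_le r
          simp only [Walk.length_cons] at hlen
          omega
        have hnadj : ¬ G.Adj x w := fun h => by
          have := dist_le (Walk.cons h r)
          simp only [Walk.length_cons] at hlen this
          omega
        have hur : u ∉ r.support :=
          ((Walk.cons_isPath_iff huw r).1 (Walk.isPath_of_length_eq_dist _ hq)).2
        obtain ⟨t, hxt, htw, htu⟩ : ∃ t, G.Adj x t ∧ G.Adj t w ∧ t ≠ u := by
          by_contra! h
          exact hu ⟨x, w, hxw, hnadj, hxv, huw, h⟩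
        refine ⟨.cons hxt (.cons htw r), by simpa using hlen, fun h => ?_⟩
        simp only [Walk.support_cons, List.mem_cons] at h
        rcases h with h | h | h
        · exact .inl h
        · exact absurd h.symm htu
        · exact absurd h hur
    · refine ⟨.cons hxv q, hlen, fun h => ?_⟩
      rw [Walk.support_cons, List.mem_cons] at h
      exact h.imp_right fun h => (hqu h).resolve_left huv

theorem isTotalMVSet_singleton_iff {V : Type*} {G : SimpleGraph V} (hG : G.Connected) (u : V) :
    IsTotalMVSet G {u} ↔ IsBypassVertex G u := by
  constructor
  · rintro h ⟨x, y, hxy, hnadj, hxu, huy, huniq⟩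
    obtain ⟨p, -, hl, hv⟩ := h x y
    have h2 : p.length ≤ 2 := hl ▸ dist_le (Walk.cons hxu (Walk.cons huy .nil))
    match p, h2, hv with
    | .nil, _, _ => exact hxy rfl
    | .cons h1 .nil, _, _ => exact hnadj h1
    | .cons h1 (.cons h2 .nil), _, hv =>
      obtain rfl := huniq _ h1 h2
      rcases hv _ (by simp) rfl with h | h
      · exact hxu.ne h.symm
      · exact huy.ne h
    | .cons _ (.cons _ (.cons _ r)), h2, _ =>
      simp only [Walk.length_cons] at h2
      omega
  · intro hu x y
    obtain ⟨p, hp⟩ := hG.exists_walk_length_eq_dist x y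
    obtain ⟨q, hq, hqu⟩ := hu.exists_walk p hp
    exact ⟨q, q.isPath_of_length_eq_dist hq, hq, fun z hz hzu => by
      obtain rfl : z = u := hzu
      exact hqu hz⟩

theorem totalMVNum_eq_zero_iff {V : Type*} [Finite V] {G : SimpleGraph V} (hG : G.Connected) :
    totalMVNum G = 0 ↔ ∀ u, ¬ IsBypassVertex G u := by
  simp only [← isTotalMVSet_singleton_iff hG]
  constructor
  · intro h u hu
    have hbdd : BddAbove {n : ℕ | ∃ X : Set V, IsTotalMVSet G X ∧ X.ncard = n} := by
      refine ⟨Nat.card V, ?_⟩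
      rintro _ ⟨X, -, rfl⟩
      exact Set.ncard_le_card X
    have : 1 ≤ totalMVNum G := le_csSup hbdd ⟨{u}, hu, Set.ncard_singleton u⟩
    omega
  · intro h
    refine Nat.le_zero.1 (csSup_le' ?_)
    rintro _ ⟨X, hX, rfl⟩
    rcases X.eq_empty_or_nonempty with rfl | ⟨u, hu⟩
    · simp
    · exact absurd (hX.subset (Set.singleton_subset_iff.2 hu)) (h u)

theorem isBypassVertex_boxProd_iff {V W : Type*} {G : SimpleGraph V} {H : SimpleGraph W}
    (g : V) (h : W) :
    IsBypassVertex (G □ H) (g, h) ↔ IsBypassVertex G g ∧ IsBypassVertex H h := by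
  constructor
  · refine fun hb => ⟨?_, ?_⟩
    · rintro ⟨x, y, hxy, hn, hxg, hgy, hu⟩
      refine hb ⟨(x, h), (y, h), by simpa using hxy, by simpa using hn, by simpa using hxg,
        by simpa using hgy, ?_⟩
      rintro ⟨a, b⟩ h1 h2
      simp only [boxProd_adj] at h1 h2
      grind [SimpleGraph.irrefl]
    · rintro ⟨x, y, hxy, hn, hxh, hhy, hu⟩
      refine hb ⟨(g, x), (g, y), by simpa using hxy, by simpa using hn, by simpa using hxh,
        by simpa using hhy, ?_⟩
      rintro ⟨a, b⟩ h1 h2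
      simp only [boxProd_adj] at h1 h2
      grind [SimpleGraph.irrefl]
  · rintro ⟨hg, hh⟩ ⟨⟨x₁, x₂⟩, ⟨y₁, y₂⟩, hxy, hn, hx, hy, hu⟩
    simp only [boxProd_adj] at hn hx hy
    rcases hx with ⟨hx, rfl⟩ | ⟨hx, rfl⟩ <;> rcases hy with ⟨hy, rfl⟩ | ⟨hy, rfl⟩
    · exact hg ⟨x₁, y₁, by simpa using hxy, by simpa using hn, hx, hy, fun w h1 h2 =>
        congrArg Prod.fst (hu (w, x₂) (by simpa using h1) (by simpa using h2))⟩
    · exact hx.ne (congrArg Prod.fst (hu (x₁, y₂) (by simpa using hy) (by simpa using hx)))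
    · exact hx.ne (congrArg Prod.snd (hu (y₁, x₂) (by simpa using hy) (by simpa using hx)))
    · exact hh ⟨x₂, y₂, by simpa using hxy, by simpa using hn, hx, hy, fun w h1 h2 =>
        congrArg Prod.snd (hu (x₁, w) (by simpa using h1) (by simpa using h2))⟩

/-- For connected graphs `G` and `H`, `μt(G □ H) = 0` iff `μt(G) = 0` or `μt(H) = 0`. -/
theorem totalMVNum_boxProd_eq_zero_iff {V W : Type*} [Fintype V] [Fintype W]
    (G : SimpleGraph V) (H : SimpleGraph W) (hG : G.Connected) (hH : H.Connected) :
    totalMVNum (G □ H) = 0 ↔ totalMVNum G = 0 ∨ totalMVNum H = 0 := by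
  rw [totalMVNum_eq_zero_iff (hG.boxProd hH), totalMVNum_eq_zero_iff hG,
    totalMVNum_eq_zero_iff hH]
  simp only [Prod.forall, isBypassVertex_boxProd_iff, not_and_or, forall_or_left, forall_or_right]
end

section
/- If G and H are connected graphs with μt(G □ H) = 1, then μt(G) = 1 and μt(H) = 1. -/
open SimpleGraph

namespace SimpleGraph

variable {V W : Type*} {G : SimpleGraph V} {H : SimpleGraph W}

theorem Connected.dist_boxProd (hG : G.Connected) (hH : H.Connected) (x y : V × W) :
    (G □ H).dist x y = G.dist x.1 y.1 + H.dist x.2 y.2 := by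
  unfold SimpleGraph.dist
  rw [edist_boxProd, ENat.toNat_add (edist_ne_top_iff_reachable.2 (hG _ _))
    (edist_ne_top_iff_reachable.2 (hH _ _))]

theorem Walk.length_boxProdLeft {x y : V} (p : G.Walk x y) (w : W) :
    (p.boxProdLeft H w).length = p.length :=
  Walk.length_map _ _

theorem Walk.length_boxProdRight {x y : W} (p : H.Walk x y) (v : V) :
    (p.boxProdRight G v).length = p.length :=
  Walk.length_map _ _

theorem Walk.support_boxProdLeft {x y : V} (p : G.Walk x y) (w : W) :
    (p.boxProdLeft H w).support = p.support.map (·, w) :=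
  Walk.support_map _ _

theorem Walk.support_boxProdRight {x y : W} (p : H.Walk x y) (v : V) :
    (p.boxProdRight G v).support = p.support.map (v, ·) :=
  Walk.support_map _ _

/-- A walk in a box product projects to a walk in the left factor which is no longer; if no length
is lost, the original walk stays in the layer of its first vertex. -/
theorem Walk.exists_left_projection {x y : V × W} (p : (G □ H).Walk x y) :
    ∃ q : G.Walk x.1 y.1, q.length ≤ p.length ∧
      (q.length = p.length → ∀ z ∈ q.support, (z, x.2) ∈ p.support) := by
  induction p with
  | nil => exact ⟨.nil, le_rfl, by simp⟩
  | @cons u v w hadj p ih =>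
    obtain ⟨q, hle, hq⟩ := ih
    rcases boxProd_adj.1 hadj with ⟨ha, he⟩ | ⟨-, he⟩
    · refine ⟨.cons ha q, by simpa using hle, fun hlen z hz ↦ ?_⟩
      rw [Walk.support_cons, List.mem_cons] at hz ⊢
      rcases hz with rfl | hz
      · exact .inl rfl
      · exact .inr (he ▸ hq (by simpa using hlen) z hz)
    · refine ⟨q.copy he.symm rfl, ?_, fun hlen ↦ ?_⟩
      · simp only [Walk.length_copy, Walk.length_cons]
        lia
      · simp only [Walk.length_copy, Walk.length_cons] at hlen
        lia

end SimpleGraph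

section TotalMutualVisibility

variable {V W : Type*} {G : SimpleGraph V} {H : SimpleGraph W}

theorem isTotalMVSet_of_exists_walk {X : Set V}
    (hX : ∀ x y : V, ∃ p : G.Walk x y, p.length = G.dist x y ∧
      ∀ z ∈ p.support, z ∈ X → z = x ∨ z = y) : IsTotalMVSet G X := fun x y ↦
  let ⟨p, hp, hs⟩ := hX x y
  ⟨p, p.isPath_of_length_eq_dist hp, hp, hs⟩

theorem isTotalMVSet_empty (hG : G.Connected) : IsTotalMVSet G ∅ :=
  isTotalMVSet_of_exists_walk fun x y ↦
    let ⟨p, hp⟩ := hG.exists_walk_length_eq_dist x y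
    ⟨p, hp, by simp⟩

theorem bddAbove_ncard_isTotalMVSet [Finite V] (G : SimpleGraph V) :
    BddAbove {n : ℕ | ∃ X : Set V, IsTotalMVSet G X ∧ X.ncard = n} := by
  refine ⟨Nat.card V, ?_⟩
  rintro _ ⟨X, -, rfl⟩
  exact Set.ncard_le_card X

theorem IsTotalMVSet.ncard_le [Finite V] {X : Set V} (hX : IsTotalMVSet G X) :
    X.ncard ≤ totalMVNum G :=
  le_csSup (bddAbove_ncard_isTotalMVSet G) ⟨X, hX, rfl⟩

theorem exists_isTotalMVSet_ncard_eq [Finite V] (hG : G.Connected) :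
    ∃ X : Set V, IsTotalMVSet G X ∧ X.ncard = totalMVNum G :=
  Nat.sSup_mem (s := {n : ℕ | ∃ X : Set V, IsTotalMVSet G X ∧ X.ncard = n})
    ⟨_, ∅, isTotalMVSet_empty hG, rfl⟩ (bddAbove_ncard_isTotalMVSet G)

theorem IsTotalMVSet.preimage_iso {X : Set W} (hX : IsTotalMVSet H X) (e : G ≃g H) :
    IsTotalMVSet G (e ⁻¹' X) := by
  refine isTotalMVSet_of_exists_walk fun x y ↦ ?_
  obtain ⟨p, -, hp, hs⟩ := hX (e x) (e y)
  refine ⟨(p.map e.symm.toHom).copy (e.symm_apply_apply x) (e.symm_apply_apply y), ?_, ?_⟩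
  · obtain ⟨q, hq⟩ := (p.map e.symm.toHom).reachable.exists_walk_length_eq_dist
    refine le_antisymm ?_ (dist_le _)
    have hq' : q.length = G.dist x y := by
      rw [hq]
      exact congrArg₂ G.dist (e.symm_apply_apply x) (e.symm_apply_apply y)
    have := dist_le
      ((q.copy (e.symm_apply_apply x) (e.symm_apply_apply y)).map e.toHom)
    rw [Walk.length_map, Walk.length_copy, hq'] at this
    rw [Walk.length_copy, Walk.length_map, hp]
    exact this
  · intro z hz hzX
    rw [Walk.support_copy, Walk.support_map, List.mem_map] at hz
    obtain ⟨w, hw, rfl⟩ := hz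
    have hew : e (e.symm w) = w := e.apply_symm_apply w
    have hwX : w ∈ X := hew ▸ hzX
    rcases hs w hw hwX with rfl | rfl
    · exact .inl (e.symm_apply_apply x)
    · exact .inr (e.symm_apply_apply y)

/-- The trace of a total mutual-visibility set on a layer of a box product is one. -/
theorem IsTotalMVSet.of_boxProd {X : Set (V × W)} (hG : G.Connected) (hH : H.Connected)
    (hX : IsTotalMVSet (G □ H) X) (h : W) : IsTotalMVSet G {g | (g, h) ∈ X} := by
  refine isTotalMVSet_of_exists_walk fun x y ↦ ?_
  obtain ⟨p, -, hp, hs⟩ := hX (x, h) (y, h)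
  rw [hG.dist_boxProd hH] at hp
  simp only [dist_self, add_zero] at hp
  obtain ⟨q, hle, hq⟩ := p.exists_left_projection
  have hqd : q.length = G.dist x y := le_antisymm (hle.trans hp.le) (dist_le q)
  refine ⟨q, hqd, fun z hz hzX ↦ ?_⟩
  exact (hs _ (hq (hqd.trans hp.symm) z hz) hzX).imp (congrArg Prod.fst) (congrArg Prod.fst)

theorem IsTotalMVSet.boxProd_singleton {X : Set V} {h : W} (hG : G.Connected) (hH : H.Connected)
    (hX : IsTotalMVSet G X) (hh : IsTotalMVSet H {h}) :
    IsTotalMVSet (G □ H) (X ×ˢ {h}) := by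
  refine isTotalMVSet_of_exists_walk fun ⟨x, u⟩ ⟨y, v⟩ ↦ ?_
  obtain ⟨p, -, hp, hpX⟩ := hX x y
  obtain ⟨q, -, hq, hqh⟩ := hh u v
  by_cases hv : v = h
  · refine ⟨(p.boxProdLeft H u).append (q.boxProdRight G y), ?_, ?_⟩
    · rw [hG.dist_boxProd hH, Walk.length_append, Walk.length_boxProdLeft,
        Walk.length_boxProdRight, hp, hq]
    · rintro ⟨z, w⟩ hz ⟨hzX, rfl : w = h⟩
      rw [Walk.mem_support_append_iff, Walk.support_boxProdLeft,
        Walk.support_boxProdRight, List.mem_map, List.mem_map] at hz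
      rcases hz with ⟨a, ha, hz⟩ | ⟨b, -, hz⟩
      · obtain ⟨rfl, rfl⟩ : a = z ∧ u = w := Prod.ext_iff.1 hz
        subst hv
        exact (hpX a ha hzX).imp (congrArg (·, _)) (congrArg (·, _))
      · obtain ⟨rfl, rfl⟩ : y = z ∧ b = w := Prod.ext_iff.1 hz
        exact .inr (by rw [hv])
  · refine ⟨(q.boxProdRight G x).append (p.boxProdLeft H v), ?_, ?_⟩
    · rw [hG.dist_boxProd hH, Walk.length_append, Walk.length_boxProdLeft,
        Walk.length_boxProdRight, hp, hq, add_comm]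
    · rintro ⟨z, w⟩ hz ⟨hzX, rfl : w = h⟩
      rw [Walk.mem_support_append_iff, Walk.support_boxProdLeft,
        Walk.support_boxProdRight, List.mem_map, List.mem_map] at hz
      rcases hz with ⟨b, hb, hz⟩ | ⟨a, -, hz⟩
      · obtain ⟨rfl, rfl⟩ : x = z ∧ b = w := Prod.ext_iff.1 hz
        rcases hqh b hb rfl with rfl | rfl
        · exact .inl rfl
        · exact absurd rfl hv
      · exact absurd (Prod.ext_iff.1 hz).2 hv

theorem totalMVNum_left_eq_one [Finite V] [Finite W] {g : V} {h : W}
    (hG : G.Connected) (hH : H.Connected)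
    (hg : IsTotalMVSet G {g}) (hh : IsTotalMVSet H {h}) (hle : totalMVNum (G □ H) ≤ 1) :
    totalMVNum G = 1 := by
  refine le_antisymm ?_ (by simpa using hg.ncard_le)
  obtain ⟨X, hX, hcard⟩ := exists_isTotalMVSet_ncard_eq hG
  have := (hX.boxProd_singleton hG hH hh).ncard_le
  rw [Set.ncard_prod, Set.ncard_singleton, mul_one, hcard] at this
  exact this.trans hle

theorem totalMVNum_le_of_iso [Finite V] [Finite W] (hH : H.Connected) (e : G ≃g H) :
    totalMVNum H ≤ totalMVNum G := by
  obtain ⟨X, hX, hcard⟩ := exists_isTotalMVSet_ncard_eq hH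
  have := (hX.preimage_iso e).ncard_le
  rwa [Set.ncard_preimage_of_injective_subset_range e.injective (by simp [e.surjective.range_eq]),
    hcard] at this

end TotalMutualVisibility

/-- If `G` and `H` are connected graphs with `μt(G □ H) = 1`, then `μt(G) = 1` and
`μt(H) = 1`. -/
theorem totalMVNum_factors_of_boxProd_eq_one {V W : Type*} [Fintype V] [Fintype W]
    (G : SimpleGraph V) (H : SimpleGraph W) (hG : G.Connected) (hH : H.Connected)
    (h : totalMVNum (G □ H) = 1) :
    totalMVNum G = 1 ∧ totalMVNum H = 1 := by
  obtain ⟨X, hX, hcard⟩ := exists_isTotalMVSet_ncard_eq (hG.boxProd hH)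
  obtain ⟨⟨a, b⟩, rfl⟩ := Set.ncard_eq_one.1 (hcard.trans h)
  have ha : IsTotalMVSet G {a} := by simpa using hX.of_boxProd hG hH b
  have hb : IsTotalMVSet H {b} := by
    simpa using (hX.preimage_iso (H.boxProdComm G)).of_boxProd hH hG a
  exact ⟨totalMVNum_left_eq_one hG hH ha hb h.le, totalMVNum_left_eq_one hH hG hb ha
    ((totalMVNum_le_of_iso (hH.boxProd hG) (G.boxProdComm H)).trans h.le)⟩
end

section
/- If G and H are bypass over-visible graphs, then μt(G □ H) > μt(G) · μt(H). -/
open SimpleGraph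

/-- `G` is bypass over-visible: it contains an independent set `U` of bypass vertices which
contains a `μt`-set `U'` as a proper subset. -/
def BypassOverVisible {V : Type*} (G : SimpleGraph V) : Prop :=
  ∃ U U' : Set V, (∀ u ∈ U, IsBypassVertex G u) ∧ IsIndepVSet G U ∧
    IsTotalMVSet G U' ∧ U'.ncard = totalMVNum G ∧ U' ⊂ U

/-- `x` and `y` are `X`-visible in `G`. -/
def XVisible {V : Type*} (G : SimpleGraph V) (X : Set V) (x y : V) : Prop :=
  ∃ p : G.Walk x y, p.length = G.dist x y ∧ ∀ z ∈ p.support, z ∈ X → z = x ∨ z = y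

lemma isTotalMVSet_iff_forall_xVisible {V : Type*} {G : SimpleGraph V} {X : Set V} :
    IsTotalMVSet G X ↔ ∀ x y, XVisible G X x y := by
  refine forall₂_congr fun x y => ⟨fun ⟨p, _, h⟩ => ⟨p, h⟩, fun ⟨p, h⟩ => ⟨p, ?_, h⟩⟩
  exact p.isPath_of_length_eq_dist h.1

lemma IsTotalMVSet.ncard_le_totalMVNum {V : Type*} [Finite V] {G : SimpleGraph V} {X : Set V}
    (hX : IsTotalMVSet G X) : X.ncard ≤ totalMVNum G := by
  refine le_csSup ⟨Nat.card V, ?_⟩ ⟨X, hX, rfl⟩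
  rintro n ⟨Y, -, rfl⟩
  exact Set.ncard_le_card Y

/-- A bypass vertex inside a shortest path can be replaced by another vertex. -/
lemma IsBypassVertex.exists_reroute {V : Type*} {G : SimpleGraph V} {u g g' : V}
    (hu : IsBypassVertex G u) (p : G.Walk g g') (hp : p.length = G.dist g g')
    (hup : u ∈ p.support) (hg : g ≠ u) (hg' : u ≠ g') :
    ∃ (x y w : V) (p₁ : G.Walk g x) (p₂ : G.Walk y g'),
      G.Adj x u ∧ G.Adj u y ∧ G.Adj x w ∧ G.Adj w y ∧ w ≠ u ∧
      p₁.length + p₂.length + 2 = G.dist g g' ∧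
      (∀ z ∈ p₁.support, z ∈ p.support ∧ z ≠ u) ∧ ∀ z ∈ p₂.support, z ∈ p.support ∧ z ≠ u := by
  classical
  have hpath := p.isPath_of_length_eq_dist hp
  obtain ⟨q, r, rfl⟩ := Walk.mem_support_iff_exists_append.1 hup
  obtain ⟨x, hxu, p₁, hq⟩ := Walk.exists_eq_cons_of_ne hg.symm q.reverse
  obtain ⟨y, huy, p₂, rfl⟩ := Walk.exists_eq_cons_of_ne hg' r
  obtain rfl : q = (Walk.cons hxu p₁).reverse := by rw [← hq, Walk.reverse_reverse]
  have hlen : p₁.length + p₂.length + 2 = G.dist g g' := by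
    rw [← hp]; simp; omega
  have hnd := hpath.support_nodup
  have hxy : x ≠ y := by
    rintro rfl
    have := dist_le (p₁.reverse.append p₂)
    simp at this
    omega
  have hnadj : ¬ G.Adj x y := fun hadj => by
    have := dist_le (p₁.reverse.append (Walk.cons hadj p₂))
    simp at this
    omega
  have hw : ∃ w, G.Adj x w ∧ G.Adj w y ∧ w ≠ u := by
    by_contra! h
    exact hu ⟨x, y, hxy, hnadj, hxu.symm, huy, h⟩
  obtain ⟨w, hxw, hwy, hwu⟩ := hw
  have h₁ : u ∉ p₁.support := by
    have := hpath.of_append_left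
    rw [Walk.isPath_reverse_iff, Walk.cons_isPath_iff] at this
    exact this.2
  have h₂ : u ∉ p₂.support := by
    have := hpath.of_append_right
    rw [Walk.cons_isPath_iff] at this
    exact this.2
  refine ⟨x, y, w, p₁.reverse, p₂, hxu.symm, huy, hxw, hwy, hwu, by simpa using hlen, ?_, ?_⟩
  · intro z hz
    rw [Walk.support_reverse, List.mem_reverse] at hz
    exact ⟨by simp [Walk.mem_support_append_iff, hz], ne_of_mem_of_not_mem hz h₁⟩
  · intro z hz
    exact ⟨by simp [Walk.mem_support_append_iff, hz], ne_of_mem_of_not_mem hz h₂⟩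

section BoxProd

variable {V W : Type*} {G : SimpleGraph V} {H : SimpleGraph W}

lemma dist_boxProd_of_connected (hG : G.Connected) (hH : H.Connected) (x y : V × W) :
    (G □ H).dist x y = G.dist x.1 y.1 + H.dist x.2 y.2 := by
  rw [SimpleGraph.dist, edist_boxProd, ENat.toNat_add]
  · rfl
  · exact edist_ne_top_iff_reachable.2 (hG _ _)
  · exact edist_ne_top_iff_reachable.2 (hH _ _)

lemma SimpleGraph.Walk.length_boxProdLeft_s16 {g g' : V} (p : G.Walk g g') (h : W) :
    (p.boxProdLeft H h).length = p.length :=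
  Walk.length_map _ _

lemma SimpleGraph.Walk.length_boxProdRight_s16 {h h' : W} (q : H.Walk h h') (g : V) :
    (q.boxProdRight G g).length = q.length :=
  Walk.length_map _ _

lemma SimpleGraph.Walk.support_boxProdLeft_s16 {g g' : V} (p : G.Walk g g') (h : W) :
    (p.boxProdLeft H h).support = p.support.map (·, h) :=
  Walk.support_map _ _

lemma SimpleGraph.Walk.support_boxProdRight_s16 {h h' : W} (q : H.Walk h h') (g : V) :
    (q.boxProdRight G g).support = q.support.map (g, ·) :=
  Walk.support_map _ _

/-- Visibility along a path that runs through row `h`, then column `a`, then row `h'`. -/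
lemma xVisible_boxProd_of_column (hG : G.Connected) (hH : H.Connected) {X : Set (V × W)}
    {g a g' : V} {h h' : W} (p₁ : G.Walk g a) (p₂ : G.Walk a g')
    (hp : p₁.length + p₂.length = G.dist g g')
    (h₁ : ∀ z ∈ p₁.support, (z, h) ∈ X → z = g) (ha : ∀ b, (a, b) ∉ X)
    (h₂ : ∀ z ∈ p₂.support, (z, h') ∈ X → z = g') : XVisible (G □ H) X (g, h) (g', h') := by
  obtain ⟨q, hq⟩ := hH.exists_walk_length_eq_dist h h'
  refine ⟨((p₁.boxProdLeft H h).append (q.boxProdRight G a)).append (p₂.boxProdLeft H h'), ?_, ?_⟩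
  · rw [dist_boxProd_of_connected hG hH, ← hp, ← hq]
    simp only [Walk.length_append, Walk.length_boxProdLeft_s16, Walk.length_boxProdRight_s16]
    omega
  · rintro ⟨z, b⟩ hz hX
    simp only [Walk.mem_support_append_iff, Walk.support_boxProdLeft_s16, Walk.support_boxProdRight_s16,
      List.mem_map] at hz
    rcases hz with (⟨c, hc, e⟩ | ⟨c, hc, e⟩) | ⟨c, hc, e⟩
    · obtain ⟨rfl, rfl⟩ : c = z ∧ h = b := Prod.ext_iff.1 e
      exact .inl (by rw [h₁ c hc hX])
    · obtain ⟨rfl, rfl⟩ : a = z ∧ c = b := Prod.ext_iff.1 e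
      exact (ha _ hX).elim
    · obtain ⟨rfl, rfl⟩ : c = z ∧ h' = b := Prod.ext_iff.1 e
      exact .inr (by rw [h₂ c hc hX])

lemma XVisible.boxProd_swap (hG : G.Connected) (hH : H.Connected) {A : Set V} {B : Set W}
    {u : V} {v : W} {x y : V × W}
    (h : XVisible (H □ G) (insert (v, u) (B ×ˢ A)) x.swap y.swap) :
    XVisible (G □ H) (insert (u, v) (A ×ˢ B)) x y := by
  obtain ⟨p, hp, hX⟩ := h
  obtain ⟨q, hq, hqs⟩ : ∃ q : (G □ H).Walk x y,
      q.length = p.length ∧ q.support = p.support.map Prod.swap :=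
    ⟨p.map (boxProdComm H G).toHom, Walk.length_map _ _, Walk.support_map _ _⟩
  refine ⟨q, ?_, ?_⟩
  · rw [dist_boxProd_of_connected hG hH, hq, hp, dist_boxProd_of_connected hH hG,
      add_comm]
    rfl
  · intro z hz hzX
    rw [hqs, List.mem_map] at hz
    obtain ⟨c, hc, rfl⟩ := hz
    refine (hX c hc ?_).imp (fun e => ?_) (fun e => ?_)
    · simpa [Prod.ext_iff, and_comm] using hzX
    · rw [e]; rfl
    · rw [e]; rfl

variable {A : Set V} {B : Set W} {u : V} {v : W}

lemma xVisible_boxProd_of_xVisible_insert (hG : G.Connected) (hH : H.Connected)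
    (hA : IsIndepVSet G (insert u A)) {g g' : V} (hne : g ≠ g')
    (hvis : XVisible G (insert u A) g g') (h h' : W) :
    XVisible (G □ H) (insert (u, v) (A ×ˢ B)) (g, h) (g', h') := by
  have key : ∀ {a}, a ∉ insert u A → ∀ b : W, (a, b) ∉ (insert (u, v) (A ×ˢ B) : Set (V × W)) := by
    intro a ha b
    simp only [Set.mem_insert_iff, not_or] at ha
    simp [ha]
  have key' : ∀ {a} {b : W}, (a, b) ∈ (insert (u, v) (A ×ˢ B) : Set (V × W)) → a ∈ insert u A :=
    fun {a b} hab => by_contra fun ha => key ha b hab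
  by_cases hadj : G.Adj g g'
  · by_cases hg : g ∈ insert u A
    · have hg' : g' ∉ insert u A := fun hg' => hA _ hg _ hg' hadj
      refine xVisible_boxProd_of_column hG hH hadj.toWalk .nil ?_ ?_ (key hg') ?_
      · simp [dist_eq_one_iff_adj.2 hadj]
      · simp only [Walk.support_cons, Walk.support_nil, List.mem_cons, List.not_mem_nil, or_false]
        rintro z (rfl | rfl) hz
        · rfl
        · exact (key hg' _ hz).elim
      · simp
    · refine xVisible_boxProd_of_column hG hH .nil hadj.toWalk ?_ ?_ (key hg) ?_
      · simp [dist_eq_one_iff_adj.2 hadj]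
      · simp
      · simp only [Walk.support_cons, Walk.support_nil, List.mem_cons, List.not_mem_nil, or_false]
        rintro z (rfl | rfl) hz
        · exact (key hg _ hz).elim
        · rfl
  · obtain ⟨p, hp, hX⟩ := hvis
    obtain ⟨a, hga, q, rfl⟩ := Walk.exists_eq_cons_of_ne hne p
    have hag' : a ≠ g' := by rintro rfl; exact hadj hga
    have ha : a ∉ insert u A := fun ha => by
      rcases hX a (by simp) ha with e | e
      · exact hga.ne e.symm
      · exact hag' e
    have hpath := (Walk.cons_isPath_iff _ _).1 (Walk.isPath_of_length_eq_dist _ hp)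
    refine xVisible_boxProd_of_column hG hH hga.toWalk q ?_ ?_ (key ha) ?_
    · rw [← hp]; simp [add_comm]
    · simp only [Walk.support_cons, Walk.support_nil, List.mem_cons, List.not_mem_nil, or_false]
      rintro z (rfl | rfl) hz
      · rfl
      · exact (key ha _ hz).elim
    · intro z hz hzX
      refine (hX z (by simp [hz]) (key' hzX)).resolve_left ?_
      rintro rfl
      exact hpath.2 hz

lemma xVisible_boxProd_of_ne (hG : G.Connected) (hH : H.Connected) (hA : IsTotalMVSet G A)
    (hAi : IsIndepVSet G (insert u A)) (hu : IsBypassVertex G u) {g g' : V} (hne : g ≠ g')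
    {h h' : W} (hh : h ≠ v) (hh' : h' ≠ v) :
    XVisible (G □ H) (insert (u, v) (A ×ˢ B)) (g, h) (g', h') := by
  obtain ⟨p, hpath, hp, hX⟩ := hA g g'
  by_cases hup : u ∈ p.support ∧ g ≠ u ∧ u ≠ g'
  · obtain ⟨hup, hgu, hug'⟩ := hup
    obtain ⟨x, y, w, p₁, p₂, hxu, huy, hxw, hwy, hwu, hlen, h₁, h₂⟩ :=
      hu.exists_reroute p hp hup hgu hug'
    by_cases hw : w ∈ A
    · have hx : x ∉ A := fun hx => hAi x (.inr hx) w (.inr hw) hxw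
      have hq : ∀ z ∈ p₁.support, z ≠ g' := by
        rintro z hz rfl
        obtain ⟨q, r, rfl⟩ := Walk.mem_support_iff_exists_append.1 hz
        have := dist_le q
        simp at hlen
        omega
      have hr : ∀ z ∈ (Walk.cons hxu (Walk.cons huy p₂)).support, z = g → z ∉ A := by
        rintro z hz rfl
        simp only [Walk.support_cons, List.mem_cons] at hz
        rcases hz with rfl | rfl | hz
        · exact hx
        · exact (hgu rfl).elim
        · obtain ⟨q, r, rfl⟩ := Walk.mem_support_iff_exists_append.1 hz
          have := dist_le r
          simp at hlen
          omega
      refine xVisible_boxProd_of_column hG hH p₁ (Walk.cons hxu (Walk.cons huy p₂)) ?_ ?_ ?_ ?_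
      · rw [← hlen]; simp; omega
      · intro z hz hzX
        have hzA : z ∈ A := by simp [hh] at hzX; exact hzX.1
        exact (hX z (h₁ z hz).1 hzA).resolve_right (hq z hz)
      · simp [hx, hxu.ne]
      · intro z hz hzX
        have hzA : z ∈ A := by simp [hh'] at hzX; exact hzX.1
        have hzp : z ∈ p.support := by
          simp only [Walk.support_cons, List.mem_cons] at hz
          rcases hz with rfl | rfl | hz
          · exact (h₁ _ p₁.end_mem_support).1
          · exact hup
          · exact (h₂ z hz).1
        exact (hX z hzp hzA).resolve_left fun e => hr z hz e hzA
    · refine xVisible_boxProd_of_xVisible_insert hG hH hAi hne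
        ⟨p₁.append (Walk.cons hxw (Walk.cons hwy p₂)), ?_, ?_⟩ h h'
      · rw [← hlen]; simp; omega
      · intro z hz hzT
        simp only [Walk.mem_support_append_iff, Walk.support_cons, List.mem_cons] at hz
        have hz' : z = w ∨ z ∈ p.support ∧ z ≠ u := by
          rcases hz with hz | rfl | rfl | hz
          · exact .inr (h₁ z hz)
          · exact .inr (h₁ _ p₁.end_mem_support)
          · exact .inl rfl
          · exact .inr (h₂ z hz)
        rcases hz' with rfl | ⟨hzp, hzu⟩
        · exact (hzT.elim hwu hw).elim
        · exact hX z hzp (hzT.resolve_left hzu)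
  · refine xVisible_boxProd_of_xVisible_insert hG hH hAi hne ⟨p, hp, ?_⟩ h h'
    rintro z hz (rfl | hzA)
    · by_contra! hz'
      exact hup ⟨hz, hz'.1.symm, hz'.2⟩
    · exact hX z hz hzA

lemma xVisible_boxProd_of_fst_eq (hG : G.Connected) (hH : H.Connected) (hB : IsTotalMVSet H B)
    (hv : IsBypassVertex H v) (huA : u ∉ A) (g : V) (h h' : W) :
    XVisible (G □ H) (insert (u, v) (A ×ˢ B)) (g, h) (g, h') := by
  suffices ∃ q : H.Walk h h', q.length = H.dist h h' ∧
      ∀ b ∈ q.support, (g, b) ∈ (insert (u, v) (A ×ˢ B) : Set (V × W)) → b = h ∨ b = h' by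
    obtain ⟨q, hq, hX⟩ := this
    refine ⟨q.boxProdRight G g, ?_, ?_⟩
    · rw [dist_boxProd_of_connected hG hH]
      simp [Walk.length_boxProdRight_s16, hq]
    · rintro ⟨z, b⟩ hz hzX
      rw [Walk.support_boxProdRight_s16, List.mem_map] at hz
      obtain ⟨c, hc, e⟩ := hz
      obtain ⟨rfl, rfl⟩ : g = z ∧ c = b := Prod.ext_iff.1 e
      exact (hX c hc hzX).imp (congrArg _) (congrArg _)
  obtain ⟨q, -, hq, hX⟩ := hB h h'
  by_cases hgu : g = u
  · subst hgu
    by_cases hvq : v ∈ q.support ∧ h ≠ v ∧ v ≠ h'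
    · obtain ⟨hvq, hhv, hvh'⟩ := hvq
      obtain ⟨x, y, w, p₁, p₂, -, -, hxw, hwy, hwv, hlen, h₁, h₂⟩ :=
        hv.exists_reroute q hq hvq hhv hvh'
      refine ⟨p₁.append (Walk.cons hxw (Walk.cons hwy p₂)), by rw [← hlen]; simp; omega, ?_⟩
      intro b hb hbX
      obtain rfl : b = v := by simpa [huA] using hbX
      simp only [Walk.mem_support_append_iff, Walk.support_cons, List.mem_cons] at hb
      rcases hb with hb | rfl | rfl | hb
      · exact ((h₁ _ hb).2 rfl).elim
      · exact ((h₁ _ p₁.end_mem_support).2 rfl).elim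
      · exact (hwv rfl).elim
      · exact ((h₂ _ hb).2 rfl).elim
    · refine ⟨q, hq, fun b hb hbX => ?_⟩
      obtain rfl : b = v := by simpa [huA] using hbX
      by_contra! hb'
      exact hvq ⟨hb, hb'.1.symm, hb'.2⟩
  · refine ⟨q, hq, fun b hb hbX => hX b hb ?_⟩
    simp only [Set.mem_insert_iff, Prod.mk.injEq, hgu, false_and, false_or, Set.mem_prod] at hbX
    exact hbX.2

/-- Adding one pair of bypass vertices to the product of two total mutual-visibility sets yields a
total mutual-visibility set, provided that the factors stay independent. -/
lemma IsTotalMVSet.insert_prod (hG : G.Connected) (hH : H.Connected)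
    (hA : IsTotalMVSet G A) (hB : IsTotalMVSet H B)
    (hAi : IsIndepVSet G (insert u A)) (hBi : IsIndepVSet H (insert v B))
    (hu : IsBypassVertex G u) (hv : IsBypassVertex H v) (huA : u ∉ A) (hvB : v ∉ B) :
    IsTotalMVSet (G □ H) (insert (u, v) (A ×ˢ B)) := by
  rw [isTotalMVSet_iff_forall_xVisible]
  rintro ⟨g, h⟩ ⟨g', h'⟩
  by_cases hg : g = g'
  · subst hg
    exact xVisible_boxProd_of_fst_eq hG hH hB hv huA g h h'
  by_cases hh : h = h'
  · subst hh
    exact .boxProd_swap hG hH (xVisible_boxProd_of_fst_eq hH hG hA hu hvB h g g')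
  by_cases hvh : h ≠ v ∧ v ≠ h'
  · exact xVisible_boxProd_of_ne hG hH hA hAi hu hg hvh.1 hvh.2.symm
  · refine .boxProd_swap hG hH (xVisible_boxProd_of_xVisible_insert hH hG hBi hh ?_ g g')
    obtain ⟨q, -, hq, hX⟩ := hB h h'
    refine ⟨q, hq, ?_⟩
    rintro z hz (rfl | hzB)
    · by_contra! hz'
      exact hvh ⟨hz'.1.symm, hz'.2⟩
    · exact hX z hz hzB

end BoxProd

/-- If `G` and `H` are bypass over-visible graphs, then `μt(G □ H) > μt(G) · μt(H)`. -/
theorem totalMVNum_boxProd_gt_of_bypassOverVisible {V W : Type*} [Fintype V] [Fintype W]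
    (G : SimpleGraph V) (H : SimpleGraph W) (hG : G.Connected) (hH : H.Connected)
    (hGo : BypassOverVisible G) (hHo : BypassOverVisible H) :
    totalMVNum G * totalMVNum H < totalMVNum (G □ H) := by
  obtain ⟨U, A, hUb, hUi, hA, hAc, hAU⟩ := hGo
  obtain ⟨U', B, hUb', hUi', hB, hBc, hBU⟩ := hHo
  obtain ⟨u, huU, huA⟩ := Set.exists_of_ssubset hAU
  obtain ⟨v, hvU, hvB⟩ := Set.exists_of_ssubset hBU
  have hAi : IsIndepVSet G (insert u A) := fun x hx y hy =>
    hUi x (Set.insert_subset huU hAU.subset hx) y (Set.insert_subset huU hAU.subset hy)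
  have hBi : IsIndepVSet H (insert v B) := fun x hx y hy =>
    hUi' x (Set.insert_subset hvU hBU.subset hx) y (Set.insert_subset hvU hBU.subset hy)
  have hle := (hA.insert_prod hG hH hB hAi hBi (hUb u huU) (hUb' v hvU) huA hvB).ncard_le_totalMVNum
  rw [Set.ncard_insert_of_notMem (by simp [huA]), Set.ncard_prod, hAc, hBc] at hle
  omega
end
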